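/- Let N ≥ 2 be a fixed integer. There exist constants c, C > 0 such that for all φ ∈ (0,π) and 0 < t ≤ 1: c·(cos(φ/2))^{N−2}·(t+π−φ)^{-(N−1)/2}·t^{-N/2}·exp(−φ²/(4t)) ≤ ∫_{φ/2}^{π−φ/2} (t+π−ψ)^{-(N−1)}·t^{-(N−1/2)}·exp(−ψ²/t)·(cos φ − cos 2ψ)^{(N−3)/2}·sin ψ dψ ≤ C·(cos(φ/2))^{N−2}·(t+π−φ)^{-(N−1)/2}·t^{-N/2}·exp(−φ²/(4t)). -/

import Mathlib

lemma aux_rpow_comp (q k1 k2 : ℝ) (h1 : 0 < k1) (h2 : 0 < k2) :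
    ∃ c C : ℝ, 0 < c ∧ 0 < C ∧ ∀ B X : ℝ, 0 < B → k1 * B ≤ X → X ≤ k2 * B →
      c * B ^ q ≤ X ^ q ∧ X ^ q ≤ C * B ^ q := by
  have e1 : 0 < k1 ^ q := Real.rpow_pos_of_pos h1 q
  have e2 : 0 < k2 ^ q := Real.rpow_pos_of_pos h2 q
  rcases le_total 0 q with hq | hq
  · refine ⟨k1 ^ q, k2 ^ q, e1, e2, fun B X hB hX1 hX2 => ?_⟩
    have hk : 0 < k1 * B := by positivity
    rw [← Real.mul_rpow h1.le hB.le, ← Real.mul_rpow h2.le hB.le]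
    exact ⟨Real.rpow_le_rpow hk.le hX1 hq, Real.rpow_le_rpow (hk.le.trans hX1) hX2 hq⟩
  · refine ⟨k2 ^ q, k1 ^ q, e2, e1, fun B X hB hX1 hX2 => ?_⟩
    have hk : 0 < k1 * B := by positivity
    rw [← Real.mul_rpow h1.le hB.le, ← Real.mul_rpow h2.le hB.le]
    exact ⟨Real.rpow_le_rpow_of_nonpos (hk.trans_le hX1) hX2 hq,
      Real.rpow_le_rpow_of_nonpos hk hX1 hq⟩

lemma aux_exp (s : ℝ) (hs : 0 < s) :
    ∃ C : ℝ, 0 < C ∧ ∀ x : ℝ, 0 ≤ x → (1 + x) ^ s ≤ C * Real.exp (x / 2) := by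
  refine ⟨(1 + 2 * s) ^ s, by positivity, fun x hx => ?_⟩
  have h : 1 + x ≤ (1 + 2 * s) * Real.exp (x / (2 * s)) := by
    have h1 := Real.add_one_le_exp (x / (2 * s))
    have h2 : 1 + x ≤ (1 + 2 * s) * (x / (2 * s) + 1) := by
      have : (1 + 2 * s) * (x / (2 * s) + 1) = 1 + x + (2 * s + x / (2 * s)) := by
        field_simp; ring
      rw [this]
      have : 0 ≤ 2 * s + x / (2 * s) := by positivity
      linarith
    exact h2.trans (by gcongr)
  calc (1 + x) ^ s ≤ ((1 + 2 * s) * Real.exp (x / (2 * s))) ^ s :=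
        Real.rpow_le_rpow (by positivity) h hs.le
    _ = _ := by
        rw [Real.mul_rpow (by positivity) (by positivity), ← Real.exp_mul]
        congr 2
        field_simp

lemma aux_sin_half (x : ℝ) (h0 : 0 ≤ x) (h1 : x ≤ Real.pi / 2) :
    2 / Real.pi ^ 2 * (x * (Real.pi - x)) ≤ Real.sin x ∧
      Real.sin x ≤ 2 / Real.pi * (x * (Real.pi - x)) := by
  have hp := Real.pi_pos
  constructor
  · refine le_trans ?_ (Real.mul_le_sin h0 h1)
    have : 2 / Real.pi * x = 2 / Real.pi ^ 2 * (x * Real.pi) := by field_simp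
    rw [this]
    gcongr
    linarith
  · refine (Real.sin_le h0).trans ?_
    have : x = 2 / Real.pi * (x * (Real.pi / 2)) := by field_simp
    calc x = 2 / Real.pi * (x * (Real.pi / 2)) := this
      _ ≤ _ := by gcongr; linarith

lemma aux_sin (x : ℝ) (h0 : 0 ≤ x) (h1 : x ≤ Real.pi) :
    2 / Real.pi ^ 2 * (x * (Real.pi - x)) ≤ Real.sin x ∧
      Real.sin x ≤ 2 / Real.pi * (x * (Real.pi - x)) := by
  rcases le_total x (Real.pi / 2) with h | h
  · exact aux_sin_half x h0 h
  · have := aux_sin_half (Real.pi - x) (by linarith) (by linarith)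
    rw [Real.sin_pi_sub] at this
    have e : (Real.pi - x) * (Real.pi - (Real.pi - x)) = x * (Real.pi - x) := by ring
    rwa [e] at this

lemma aux_cos (a ψ : ℝ) (ha : 0 < a) (h1 : a < ψ) (h2 : ψ < Real.pi - a) :
    (4 / Real.pi ^ 5) * ((ψ ^ 2 - a ^ 2) * ((Real.pi - a) ^ 2 - ψ ^ 2) * (Real.pi - ψ)) ≤
        Real.cos (2 * a) - Real.cos (2 * ψ) ∧
      Real.cos (2 * a) - Real.cos (2 * ψ) ≤
      (16 / Real.pi ^ 3) * ((ψ ^ 2 - a ^ 2) * ((Real.pi - a) ^ 2 - ψ ^ 2) * (Real.pi - ψ)) := by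
  have hp := Real.pi_pos
  have hc : Real.cos (2 * a) - Real.cos (2 * ψ) = 2 * (Real.sin (ψ + a) * Real.sin (ψ - a)) := by
    rw [Real.cos_sub_cos]
    have e1 : (2 * a + 2 * ψ) / 2 = ψ + a := by ring
    have e2 : (2 * a - 2 * ψ) / 2 = -(ψ - a) := by ring
    rw [e1, e2, Real.sin_neg]; ring
  have s1 := aux_sin (ψ + a) (by linarith) (by linarith)
  have s2 := aux_sin (ψ - a) (by linarith) (by linarith)
  have hu : 0 < ψ ^ 2 - a ^ 2 := by nlinarith
  have hz : 0 < Real.pi - a - ψ := by linarith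
  have hy : 0 < Real.pi - ψ := by linarith
  have p1 : 0 ≤ (ψ + a) * (Real.pi - (ψ + a)) := mul_nonneg (by linarith) (by linarith)
  have p2 : 0 ≤ (ψ - a) * (Real.pi - (ψ - a)) := mul_nonneg (by linarith) (by linarith)
  rw [hc]
  have eP : ((ψ + a) * (Real.pi - (ψ + a))) * ((ψ - a) * (Real.pi - (ψ - a))) =
    (ψ ^ 2 - a ^ 2) * ((Real.pi - a - ψ) * (Real.pi - ψ + a)) := by ring
  have ew : (Real.pi - a) ^ 2 - ψ ^ 2 = (Real.pi - a - ψ) * (Real.pi - a + ψ) := by ring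
  constructor
  · have : 2 / Real.pi ^ 2 * ((ψ + a) * (Real.pi - (ψ + a))) *
        (2 / Real.pi ^ 2 * ((ψ - a) * (Real.pi - (ψ - a)))) ≤
        Real.sin (ψ + a) * Real.sin (ψ - a) :=
      mul_le_mul s1.1 s2.1 (by positivity) ((by positivity : (0:ℝ) ≤ _).trans s1.1)
    refine le_trans ?_ (mul_le_mul_of_nonneg_left this (by norm_num))
    have : 2 * (2 / Real.pi ^ 2 * ((ψ + a) * (Real.pi - (ψ + a))) *
        (2 / Real.pi ^ 2 * ((ψ - a) * (Real.pi - (ψ - a))))) = 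
        4 / Real.pi ^ 5 * ((ψ ^ 2 - a ^ 2) * ((Real.pi - a - ψ) * (2 * Real.pi)) * (Real.pi - ψ + a)) := by
      have : ∀ A B : ℝ, 2 * (2 / Real.pi ^ 2 * A * (2 / Real.pi ^ 2 * B)) = 8 / Real.pi ^ 4 * (A * B) := by
        intros; field_simp; ring
      rw [this, eP]; field_simp; ring
    rw [this, ew]
    gcongr <;> linarith
  · have : Real.sin (ψ + a) * Real.sin (ψ - a) ≤ 2 / Real.pi * ((ψ + a) * (Real.pi - (ψ + a))) *
        (2 / Real.pi * ((ψ - a) * (Real.pi - (ψ - a)))) :=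
      mul_le_mul s1.2 s2.2 (Real.sin_nonneg_of_nonneg_of_le_pi (by linarith) (by linarith))
        (by positivity)
    refine (mul_le_mul_of_nonneg_left this (by norm_num)).trans ?_
    have : 2 * (2 / Real.pi * ((ψ + a) * (Real.pi - (ψ + a))) *
        (2 / Real.pi * ((ψ - a) * (Real.pi - (ψ - a))))) = 
        16 / Real.pi ^ 3 * ((ψ ^ 2 - a ^ 2) * ((Real.pi - a - ψ) * Real.pi) * ((Real.pi - ψ + a) / 2)) := by
      have : ∀ A B : ℝ, 2 * (2 / Real.pi * A * (2 / Real.pi * B)) = 8 / Real.pi ^ 2 * (A * B) := by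
        intros; field_simp; ring
      rw [this, eP]; field_simp; ring
    rw [this, ew]
    have hq : 0 ≤ Real.pi - a + ψ := by linarith
    gcongr <;> linarith

/-- the basic two-sided pointwise comparison -/
lemma aux_basic (p : ℝ) : ∃ c C : ℝ, 0 < c ∧ 0 < C ∧ ∀ a t ψ : ℝ, 0 < a → 0 < t →
    a < ψ → ψ < Real.pi - a →
    c * (Real.exp (-a ^ 2 / t) * (Real.exp (-(ψ ^ 2 - a ^ 2) / t) *
        ((t + Real.pi - ψ) ^ (-(2 * p)) * (Real.pi - ψ) ^ p) *
        ((ψ ^ 2 - a ^ 2) ^ (p - 1) * ((Real.pi - a) ^ 2 - ψ ^ 2) ^ (p - 1)) * ψ)) ≤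
      (t + Real.pi - ψ) ^ (-(2 * p)) * Real.exp (-ψ ^ 2 / t) *
        (Real.cos (2 * a) - Real.cos (2 * ψ)) ^ (p - 1) * Real.sin ψ ∧
    (t + Real.pi - ψ) ^ (-(2 * p)) * Real.exp (-ψ ^ 2 / t) *
        (Real.cos (2 * a) - Real.cos (2 * ψ)) ^ (p - 1) * Real.sin ψ ≤
      C * (Real.exp (-a ^ 2 / t) * (Real.exp (-(ψ ^ 2 - a ^ 2) / t) *
        ((t + Real.pi - ψ) ^ (-(2 * p)) * (Real.pi - ψ) ^ p) *
        ((ψ ^ 2 - a ^ 2) ^ (p - 1) * ((Real.pi - a) ^ 2 - ψ ^ 2) ^ (p - 1)) * ψ)) := by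
  have hp := Real.pi_pos
  obtain ⟨c, C, hc, hC, H⟩ := aux_rpow_comp (p - 1) (4 / Real.pi ^ 5) (16 / Real.pi ^ 3)
    (by positivity) (by positivity)
  refine ⟨c * (2 / Real.pi ^ 2), C * (2 / Real.pi), by positivity, by positivity, ?_⟩
  intro a t ψ ha ht h1 h2
  have hu : 0 < ψ ^ 2 - a ^ 2 := by nlinarith
  have hw : 0 < (Real.pi - a) ^ 2 - ψ ^ 2 := by nlinarith
  have hy : 0 < Real.pi - ψ := by linarith
  have hψ : 0 < ψ := by linarith
  have hty : 0 < t + Real.pi - ψ := by linarith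
  obtain ⟨b1, b2⟩ := aux_cos a ψ ha h1 h2
  obtain ⟨g1, g2⟩ := H _ _ (by positivity) b1 b2
  obtain ⟨s1, s2⟩ := aux_sin ψ (by linarith) (by linarith)
  have eE : Real.exp (-ψ ^ 2 / t) = Real.exp (-a ^ 2 / t) * Real.exp (-(ψ ^ 2 - a ^ 2) / t) := by
    rw [← Real.exp_add]; congr 1; field_simp; ring
  have eR : ((ψ ^ 2 - a ^ 2) * ((Real.pi - a) ^ 2 - ψ ^ 2) * (Real.pi - ψ)) ^ (p - 1) * (Real.pi - ψ)
     = (ψ ^ 2 - a ^ 2) ^ (p - 1) * ((Real.pi - a) ^ 2 - ψ ^ 2) ^ (p - 1) * (Real.pi - ψ) ^ p := by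
    rw [Real.mul_rpow (by positivity) hy.le, Real.mul_rpow hu.le hw.le, mul_assoc _ _ (Real.pi - ψ),
      ← Real.rpow_add_one hy.ne']
    congr 2; ring
  have hX : 0 ≤ (Real.cos (2 * a) - Real.cos (2 * ψ)) ^ (p - 1) :=
    le_trans (by positivity) g1
  rw [eE]
  set B := (ψ ^ 2 - a ^ 2) * ((Real.pi - a) ^ 2 - ψ ^ 2) * (Real.pi - ψ)
  set P := (t + Real.pi - ψ) ^ (-(2 * p)) * (Real.exp (-a ^ 2 / t) * Real.exp (-(ψ ^ 2 - a ^ 2) / t)) with hP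
  have hP0 : 0 ≤ P := by positivity
  have hB0 : 0 ≤ B ^ (p - 1) := by positivity
  have key : ∀ k l : ℝ, k * l * (Real.exp (-a ^ 2 / t) * (Real.exp (-(ψ ^ 2 - a ^ 2) / t) *
        ((t + Real.pi - ψ) ^ (-(2 * p)) * (Real.pi - ψ) ^ p) *
        ((ψ ^ 2 - a ^ 2) ^ (p - 1) * ((Real.pi - a) ^ 2 - ψ ^ 2) ^ (p - 1)) * ψ)) =
        P * (k * B ^ (p - 1)) * (l * (ψ * (Real.pi - ψ))) := by
    intro k l
    calc _ = k * l * P * ψ * ((ψ ^ 2 - a ^ 2) ^ (p - 1) * ((Real.pi - a) ^ 2 - ψ ^ 2) ^ (p - 1) * (Real.pi - ψ) ^ p) := by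
          rw [hP]; ring
      _ = _ := by rw [← eR]; ring
  rw [key, key]
  have hs : 0 ≤ Real.sin ψ := le_trans (by positivity) s1
  constructor
  · gcongr
  · gcongr

lemma aux_y (p : ℝ) (hp0 : 0 < p) : ∃ C : ℝ, 0 < C ∧ ∀ a t ψ : ℝ, 0 < a → a < Real.pi / 2 →
    0 < t → a < ψ → ψ < Real.pi - a →
    Real.exp (-(ψ ^ 2 - a ^ 2) / t) * ((t + Real.pi - ψ) ^ (-(2 * p)) * (Real.pi - ψ) ^ p) ≤
      C * Real.exp (-((ψ ^ 2 - a ^ 2) / t / 2)) := by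
  obtain ⟨C1, hC1, H⟩ := aux_exp p hp0
  have hp := Real.pi_pos
  refine ⟨C1 + (1 / 10 : ℝ) ^ (-p), by positivity, ?_⟩
  intro a t ψ ha ha2 ht h1 h2
  have hu : 0 < ψ ^ 2 - a ^ 2 := by nlinarith
  have hy : 0 < Real.pi - ψ := by linarith
  have hty : 0 < t + Real.pi - ψ := by linarith
  have st1 : (t + Real.pi - ψ) ^ (-(2 * p)) * (Real.pi - ψ) ^ p ≤ (t + Real.pi - ψ) ^ (-p) := by
    calc (t + Real.pi - ψ) ^ (-(2 * p)) * (Real.pi - ψ) ^ p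
        ≤ (t + Real.pi - ψ) ^ (-(2 * p)) * (t + Real.pi - ψ) ^ p := by
          gcongr; linarith
      _ = _ := by rw [← Real.rpow_add hty]; congr 1; ring
  have st2 : (t + Real.pi - ψ) ^ (-p) ≤
      (C1 + (1 / 10 : ℝ) ^ (-p)) * Real.exp ((ψ ^ 2 - a ^ 2) / t / 2) := by
    have hE : 1 ≤ Real.exp ((ψ ^ 2 - a ^ 2) / t / 2) := Real.one_le_exp (by positivity)
    have hT : (0:ℝ) < (1 / 10 : ℝ) ^ (-p) := by positivity
    rcases le_total (1 / 10) (Real.pi - ψ) with h | h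
    · have : (t + Real.pi - ψ) ^ (-p) ≤ (1 / 10 : ℝ) ^ (-p) :=
        Real.rpow_le_rpow_of_nonpos (by norm_num) (by linarith) (by linarith)
      nlinarith
    · have e1 : (t + Real.pi - ψ) ^ (-p) ≤ t ^ (-p) :=
        Real.rpow_le_rpow_of_nonpos ht (by linarith) (by linarith)
      have e2 : t ^ (-p) ≤ (1 + 1 / t) ^ p := by
        rw [Real.rpow_neg ht.le, ← Real.inv_rpow ht.le]
        apply Real.rpow_le_rpow (by positivity) _ hp0.le
        rw [one_div]; linarith
      have e3 := H (1 / t) (by positivity)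
      have hu1 : 1 ≤ ψ ^ 2 - a ^ 2 := by
        have := Real.pi_gt_three
        have := Real.pi_lt_four
        nlinarith
      have e4 : Real.exp (1 / t / 2) ≤ Real.exp ((ψ ^ 2 - a ^ 2) / t / 2) := by
        gcongr
      nlinarith
  have eE : Real.exp (-(ψ ^ 2 - a ^ 2) / t) * Real.exp ((ψ ^ 2 - a ^ 2) / t / 2) =
      Real.exp (-((ψ ^ 2 - a ^ 2) / t / 2)) := by
    rw [← Real.exp_add]; congr 1; ring
  calc _ ≤ Real.exp (-(ψ ^ 2 - a ^ 2) / t) *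
        ((C1 + (1 / 10 : ℝ) ^ (-p)) * Real.exp ((ψ ^ 2 - a ^ 2) / t / 2)) := by
        exact mul_le_mul_of_nonneg_left (st1.trans st2) (Real.exp_pos _).le
    _ = _ := by rw [← eE]; ring

/-- the model density -/
noncomputable def auxG (p t u : ℝ) : ℝ := u ^ (p - 1) * (1 + u / t) ^ (-(p + 1))

/-- its antiderivative, up to the factor `p` -/
noncomputable def auxF (p t u : ℝ) : ℝ := (u / (1 + u / t)) ^ p

lemma auxG_pos (p t u : ℝ) (ht : 0 < t) (hu : 0 < u) : 0 < auxG p t u := by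
  unfold auxG; positivity

lemma auxF_deriv (p t u : ℝ) (ht : 0 < t) (hu : 0 < u) :
    HasDerivAt (auxF p t) (p * auxG p t u) u := by
  have h1 : 0 < 1 + u / t := by positivity
  have hd : HasDerivAt (fun u : ℝ => u / (1 + u / t)) (1 / (1 + u / t) ^ 2) u := by
    have := (hasDerivAt_id u).div (((hasDerivAt_id u).div_const t).const_add 1) h1.ne'
    refine this.congr_deriv ?_
    simp only [id]
    field_simp
    ring
  have h2 : 0 < u / (1 + u / t) := by positivity
  have := hd.rpow_const (p := p) (Or.inl h2.ne')
  refine HasDerivAt.congr_deriv (f := auxF p t) this ?_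
  unfold auxG
  rw [Real.div_rpow hu.le h1.le, Real.rpow_neg h1.le]
  have e : (1 + u / t) ^ (p + 1) = (1 + u / t) ^ (p - 1) * (1 + u / t) ^ 2 := by
    rw [← Real.rpow_natCast, ← Real.rpow_add h1]; congr 1; push_cast; ring
  rw [e]
  field_simp

lemma auxF_cont (p t : ℝ) (hp : 0 < p) (ht : 0 < t) :
    ContinuousOn (auxF p t) (Set.Ici 0) := by
  unfold auxF
  apply ContinuousOn.rpow_const
  · apply ContinuousOn.div (by fun_prop) (by fun_prop)
    intro x hx
    have : (0:ℝ) ≤ x := hx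
    positivity
  · intro x _; right; exact hp.le

lemma aux_upper_split (p : ℝ) (hp0 : 0 < p) : ∃ C : ℝ, 0 < C ∧ ∀ t u w : ℝ,
    0 < t → 0 < u → 0 < w →
    Real.exp (-(u / t / 2)) * (u ^ (p - 1) * w ^ (p - 1)) ≤
      C * ((u + w) ^ (p - 1) * (auxG p t u + auxG p t w)) := by
  obtain ⟨C1, hC1, H1⟩ := aux_exp (p + 1) (by linarith)
  obtain ⟨c2, C2, hc2, hC2, H2⟩ := aux_rpow_comp (p - 1) (1 / 2) 1 (by norm_num) (by norm_num)
  refine ⟨C1 * C2, by positivity, ?_⟩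
  have main : ∀ t u w : ℝ, 0 < t → 0 < u → 0 < w → u ≤ w →
      Real.exp (-(u / t / 2)) * (u ^ (p - 1) * w ^ (p - 1)) ≤
      C1 * C2 * ((u + w) ^ (p - 1) * auxG p t u) := by
    intro t u w ht hu hw huw
    have h2 := (H2 (u + w) w (by positivity) (by linarith) (by linarith)).2
    have h1 := H1 (u / t) (by positivity)
    have h3 : Real.exp (-(u / t / 2)) ≤ C1 * (1 + u / t) ^ (-(p + 1)) := by
      rw [Real.exp_neg, Real.rpow_neg (by positivity), ← div_eq_mul_inv, inv_eq_one_div,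
        div_le_div_iff₀ (by positivity) (by positivity)]
      linarith
    calc _ ≤ (C1 * (1 + u / t) ^ (-(p + 1))) * (u ^ (p - 1) * (C2 * (u + w) ^ (p - 1))) := by
          gcongr
      _ = _ := by unfold auxG; ring
  intro t u w ht hu hw
  have gu := auxG_pos p t u ht hu
  have gw := auxG_pos p t w ht hw
  rcases le_total u w with h | h
  · refine (main t u w ht hu hw h).trans ?_
    gcongr; linarith
  · calc _ ≤ Real.exp (-(w / t / 2)) * (w ^ (p - 1) * u ^ (p - 1)) := by
          rw [mul_comm (w ^ (p - 1))]
          gcongr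
      _ ≤ _ := main t w u ht hw hu h
      _ ≤ _ := by rw [add_comm w u]; gcongr; linarith

lemma aux_upper_pt (p : ℝ) (hp0 : 0 < p) : ∃ C : ℝ, 0 < C ∧ ∀ a t ψ : ℝ, 0 < a →
    a < Real.pi / 2 → 0 < t → a < ψ → ψ < Real.pi - a →
    (t + Real.pi - ψ) ^ (-(2 * p)) * Real.exp (-ψ ^ 2 / t) *
        (Real.cos (2 * a) - Real.cos (2 * ψ)) ^ (p - 1) * Real.sin ψ ≤
      C * (Real.exp (-a ^ 2 / t) * (Real.pi * (Real.pi - 2 * a)) ^ (p - 1)) *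
        (p * auxG p t (ψ ^ 2 - a ^ 2) * (2 * ψ) +
          p * auxG p t ((Real.pi - a) ^ 2 - ψ ^ 2) * (2 * ψ)) := by
  obtain ⟨_, C1, _, hC1, H1⟩ := aux_basic p
  obtain ⟨C2, hC2, H2⟩ := aux_y p hp0
  obtain ⟨C3, hC3, H3⟩ := aux_upper_split p hp0
  refine ⟨C1 * C2 * C3 / (2 * p), by positivity, ?_⟩
  intro a t ψ ha ha2 ht h1 h2
  have hu : 0 < ψ ^ 2 - a ^ 2 := by nlinarith
  have hw : 0 < (Real.pi - a) ^ 2 - ψ ^ 2 := by nlinarith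
  have hψ : 0 < ψ := by linarith
  have b1 := (H1 a t ψ ha ht h1 h2).2
  have b2 := H2 a t ψ ha ha2 ht h1 h2
  have b3 := H3 t _ _ ht hu hw
  have eD : (ψ ^ 2 - a ^ 2) + ((Real.pi - a) ^ 2 - ψ ^ 2) = Real.pi * (Real.pi - 2 * a) := by ring
  rw [eD] at b3
  refine b1.trans ?_
  calc _ ≤ C1 * (Real.exp (-a ^ 2 / t) * (C2 * Real.exp (-((ψ ^ 2 - a ^ 2) / t / 2)) *
        ((ψ ^ 2 - a ^ 2) ^ (p - 1) * ((Real.pi - a) ^ 2 - ψ ^ 2) ^ (p - 1)) * ψ)) := by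
        gcongr
    _ = C1 * Real.exp (-a ^ 2 / t) * C2 * ψ * (Real.exp (-((ψ ^ 2 - a ^ 2) / t / 2)) *
        ((ψ ^ 2 - a ^ 2) ^ (p - 1) * ((Real.pi - a) ^ 2 - ψ ^ 2) ^ (p - 1))) := by ring
    _ ≤ C1 * Real.exp (-a ^ 2 / t) * C2 * ψ * (C3 * ((Real.pi * (Real.pi - 2 * a)) ^ (p - 1) *
        (auxG p t (ψ ^ 2 - a ^ 2) + auxG p t ((Real.pi - a) ^ 2 - ψ ^ 2)))) := by
        gcongr
    _ = _ := by field_simp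

lemma aux_lower_pt (p : ℝ) (hp0 : 0 < p) : ∃ c : ℝ, 0 < c ∧ ∀ a t ψ : ℝ, 0 < a →
    a < Real.pi / 2 → 0 < t → t ≤ 1 → a < ψ → ψ < Real.pi - a → ψ ^ 2 - a ^ 2 ≤ t →
    ψ ^ 2 - a ^ 2 ≤ (Real.pi * (Real.pi - 2 * a)) / 2 →
    c * (Real.exp (-a ^ 2 / t) * (Real.pi * (Real.pi - 2 * a)) ^ (p - 1)) *
        (p * (ψ ^ 2 - a ^ 2) ^ (p - 1) * (2 * ψ)) ≤
    (t + Real.pi - ψ) ^ (-(2 * p)) * Real.exp (-ψ ^ 2 / t) *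
        (Real.cos (2 * a) - Real.cos (2 * ψ)) ^ (p - 1) * Real.sin ψ := by
  obtain ⟨c1, _, hc1, _, H1⟩ := aux_basic p
  obtain ⟨c2, _, hc2, _, H2⟩ := aux_rpow_comp (p - 1) (1 / 2) 1 (by norm_num) (by norm_num)
  have hpi := Real.pi_pos
  refine ⟨c1 * (Real.exp (-1) * ((5:ℝ) ^ (-(2 * p)) * (1 / 2 : ℝ) ^ p) * c2) / (2 * p),
    by positivity, ?_⟩
  intro a t ψ ha ha2 ht ht1 h1 h2 hut huD
  have hu : 0 < ψ ^ 2 - a ^ 2 := by nlinarith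
  have hw : 0 < (Real.pi - a) ^ 2 - ψ ^ 2 := by nlinarith
  have hψ : 0 < ψ := by linarith
  have p3 := Real.pi_gt_three
  have p4 := Real.pi_lt_four
  have hD : 0 < Real.pi * (Real.pi - 2 * a) := mul_pos hpi (by linarith)
  have b1 := (H1 a t ψ ha ht h1 h2).1
  have b2 := (H2 (Real.pi * (Real.pi - 2 * a)) ((Real.pi - a) ^ 2 - ψ ^ 2) hD
    (by nlinarith) (by nlinarith)).1
  have hy : 1 / 2 ≤ Real.pi - ψ := by
    by_contra hcon
    push Not at hcon
    have : ψ ^ 2 ≤ Real.pi ^ 2 / 2 := by nlinarith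
    nlinarith
  have e1 : Real.exp (-1) ≤ Real.exp (-(ψ ^ 2 - a ^ 2) / t) := by
    rw [Real.exp_le_exp, neg_div, neg_le_neg_iff, div_le_one ht]; exact hut
  have e2 : (5:ℝ) ^ (-(2 * p)) ≤ (t + Real.pi - ψ) ^ (-(2 * p)) :=
    Real.rpow_le_rpow_of_nonpos (by linarith) (by linarith) (by linarith)
  have e3 : (1 / 2 : ℝ) ^ p ≤ (Real.pi - ψ) ^ p :=
    Real.rpow_le_rpow (by norm_num) hy hp0.le
  have hty : 0 < t + Real.pi - ψ := by linarith
  refine le_trans ?_ b1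
  calc _ = c1 * (Real.exp (-a ^ 2 / t) * (Real.exp (-1) * ((5:ℝ) ^ (-(2 * p)) * (1 / 2 : ℝ) ^ p) *
        ((ψ ^ 2 - a ^ 2) ^ (p - 1) * (c2 * (Real.pi * (Real.pi - 2 * a)) ^ (p - 1))) * ψ)) := by
        field_simp
    _ ≤ _ := by gcongr

/-- the integrand, without the power of `t` in front -/
noncomputable def auxH (p a t ψ : ℝ) : ℝ :=
  (t + Real.pi - ψ) ^ (-(2 * p)) * Real.exp (-ψ ^ 2 / t) *
        (Real.cos (2 * a) - Real.cos (2 * ψ)) ^ (p - 1) * Real.sin ψ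

lemma auxH_meas (p a t : ℝ) : Measurable (auxH p a t) := by
  unfold auxH; fun_prop

lemma auxH_nonneg (p a t ψ : ℝ) (ha : 0 < a) (ht : 0 < t)
    (h1 : a < ψ) (h2 : ψ < Real.pi - a) : 0 ≤ auxH p a t ψ := by
  obtain ⟨c1, _, hc1, _, H1⟩ := aux_basic p
  have hu : 0 < ψ ^ 2 - a ^ 2 := by nlinarith
  have hw : 0 < (Real.pi - a) ^ 2 - ψ ^ 2 := by nlinarith
  have hψ : 0 < ψ := by linarith
  have hy : 0 < Real.pi - ψ := by linarith
  have hty : 0 < t + Real.pi - ψ := by linarith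
  refine le_trans ?_ (H1 a t ψ ha ht h1 h2).1
  positivity

lemma aux_int_upper (p : ℝ) (hp0 : 0 < p) : ∃ C : ℝ, 0 < C ∧ ∀ a t : ℝ, 0 < a →
    a < Real.pi / 2 → 0 < t →
    IntervalIntegrable (auxH p a t) MeasureTheory.volume a (Real.pi - a) ∧
    ∫ ψ in a..(Real.pi - a), auxH p a t ψ ≤
      C * (Real.exp (-a ^ 2 / t) * (Real.pi * (Real.pi - 2 * a)) ^ (p - 1)) *
        auxF p t (Real.pi * (Real.pi - 2 * a)) := by
  obtain ⟨C, hC, H⟩ := aux_upper_pt p hp0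
  refine ⟨C * 2, by positivity, ?_⟩
  intro a t ha ha2 ht
  have hab : a ≤ Real.pi - a := by linarith
  set Φ : ℝ → ℝ := fun ψ => auxF p t (ψ ^ 2 - a ^ 2) - auxF p t ((Real.pi - a) ^ 2 - ψ ^ 2) with hΦ
  set Φ' : ℝ → ℝ := fun ψ => p * auxG p t (ψ ^ 2 - a ^ 2) * (2 * ψ) +
          p * auxG p t ((Real.pi - a) ^ 2 - ψ ^ 2) * (2 * ψ) with hΦ'
  have hcont : ContinuousOn Φ (Set.Icc a (Real.pi - a)) := by
    apply ContinuousOn.sub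
    · apply (auxF_cont p t hp0 ht).comp (by fun_prop)
      intro x hx
      simp only [Set.mem_Ici]
      nlinarith [hx.1, hx.2]
    · apply (auxF_cont p t hp0 ht).comp (by fun_prop)
      intro x hx
      simp only [Set.mem_Ici]
      nlinarith [hx.1, hx.2]
  have hderiv : ∀ x ∈ Set.Ioo a (Real.pi - a), HasDerivAt Φ (Φ' x) x := by
    intro x hx
    have hu : 0 < x ^ 2 - a ^ 2 := by nlinarith [hx.1, hx.2]
    have hw : 0 < (Real.pi - a) ^ 2 - x ^ 2 := by nlinarith [hx.1, hx.2]
    have d0 : HasDerivAt (fun x : ℝ => x ^ 2) (2 * x) x := by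
      simpa using hasDerivAt_pow 2 x
    have d1 := (auxF_deriv p t _ ht hu).comp x (d0.sub_const (a ^ 2))
    have d2 := (auxF_deriv p t _ ht hw).comp x (d0.const_sub ((Real.pi - a) ^ 2))
    refine HasDerivAt.congr_deriv (f := Φ) (d1.sub d2) ?_
    simp only [hΦ']; ring
  have hpos : ∀ x ∈ Set.Ioo a (Real.pi - a), 0 ≤ Φ' x := by
    intro x hx
    have hu : 0 < x ^ 2 - a ^ 2 := by nlinarith [hx.1, hx.2]
    have hw : 0 < (Real.pi - a) ^ 2 - x ^ 2 := by nlinarith [hx.1, hx.2]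
    have hx0 : 0 < x := by linarith [hx.1]
    have gu := auxG_pos p t _ ht hu
    have gw := auxG_pos p t _ ht hw
    simp only [hΦ']; positivity
  have hint : IntervalIntegrable Φ' MeasureTheory.volume a (Real.pi - a) :=
    (intervalIntegrable_iff_integrableOn_Ioc_of_le hab).2
      (intervalIntegral.integrableOn_deriv_of_nonneg hcont hderiv hpos)
  have hval := intervalIntegral.integral_eq_sub_of_hasDerivAt_of_le hab hcont hderiv hint
  have hval2 : Φ (Real.pi - a) - Φ a = 2 * auxF p t (Real.pi * (Real.pi - 2 * a)) := by
    have e0 : auxF p t 0 = 0 := by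
      unfold auxF; simp [Real.zero_rpow hp0.ne']
    have e1 : (Real.pi - a) ^ 2 - a ^ 2 = Real.pi * (Real.pi - 2 * a) := by ring
    simp only [hΦ, sub_self, e0, e1]; ring
  set K := C * (Real.exp (-a ^ 2 / t) * (Real.pi * (Real.pi - 2 * a)) ^ (p - 1)) with hK
  have hle : ∀ x ∈ Set.Ioo a (Real.pi - a), auxH p a t x ≤ K * Φ' x := by
    intro x hx
    exact H a t x ha ha2 ht hx.1 hx.2
  have hintH : IntervalIntegrable (auxH p a t) MeasureTheory.volume a (Real.pi - a) := by
    rw [intervalIntegrable_iff_integrableOn_Ioo_of_le hab]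
    have h2 := (intervalIntegrable_iff_integrableOn_Ioo_of_le hab).1 (hint.const_mul K)
    refine MeasureTheory.Integrable.mono' h2 (auxH_meas p a t).aestronglyMeasurable ?_
    refine (MeasureTheory.ae_restrict_iff' measurableSet_Ioo).2 (Filter.Eventually.of_forall ?_)
    intro x hx
    rw [Real.norm_of_nonneg (auxH_nonneg p a t x ha ht hx.1 hx.2)]
    exact hle x hx
  refine ⟨hintH, ?_⟩
  calc _ ≤ ∫ ψ in a..(Real.pi - a), K * Φ' ψ :=
        intervalIntegral.integral_mono_on_of_le_Ioo hab hintH (hint.const_mul K) hle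
    _ = _ := by
        rw [intervalIntegral.integral_const_mul, hval, hval2, hK]; ring

lemma aux_int_lower (p : ℝ) (hp0 : 0 < p) : ∃ c : ℝ, 0 < c ∧ ∀ a t : ℝ, 0 < a →
    a < Real.pi / 2 → 0 < t → t ≤ 1 →
      c * (Real.exp (-a ^ 2 / t) * (Real.pi * (Real.pi - 2 * a)) ^ (p - 1)) *
        auxF p t (Real.pi * (Real.pi - 2 * a)) ≤ 
      ∫ ψ in a..(Real.pi - a), auxH p a t ψ := by
  obtain ⟨_, _, Hup⟩ := aux_int_upper p hp0
  obtain ⟨c, hc, H⟩ := aux_lower_pt p hp0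
  refine ⟨c * (1 / 2) ^ p, by positivity, ?_⟩
  intro a t ha ha2 ht ht1
  have hintH := (Hup a t ha ha2 ht).1
  have hpi := Real.pi_pos
  have hD : 0 < Real.pi * (Real.pi - 2 * a) := mul_pos hpi (by linarith)
  set D := Real.pi * (Real.pi - 2 * a) with hDdef
  set R := D / (1 + D / t) with hR
  have hR0 : 0 < R := by positivity
  have hRt : R ≤ t := by
    rw [hR, div_le_iff₀ (by positivity)]
    have : t * (1 + D / t) = t + D := by field_simp
    linarith
  have hRD : R ≤ D := div_le_self hD.le (by
    have : 0 < D / t := by positivity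
    linarith)
  set b := Real.sqrt (a ^ 2 + R / 2) with hb
  have hb2 : b ^ 2 = a ^ 2 + R / 2 := Real.sq_sqrt (by positivity)
  have hb0 : 0 ≤ b := Real.sqrt_nonneg _
  have hab : a ≤ b := by nlinarith
  have hbp : b ≤ Real.pi - a := by
    by_contra hcon
    push Not at hcon
    nlinarith
  set Φ : ℝ → ℝ := fun ψ => (ψ ^ 2 - a ^ 2) ^ p with hΦ
  set Φ' : ℝ → ℝ := fun ψ => p * (ψ ^ 2 - a ^ 2) ^ (p - 1) * (2 * ψ) with hΦ'
  have hcont : ContinuousOn Φ (Set.Icc a b) := by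
    apply ContinuousOn.rpow_const (by fun_prop)
    intro x _; right; exact hp0.le
  have hderiv : ∀ x ∈ Set.Ioo a b, HasDerivAt Φ (Φ' x) x := by
    intro x hx
    have hu : 0 < x ^ 2 - a ^ 2 := by nlinarith [hx.1, hx.2]
    have d0 : HasDerivAt (fun x : ℝ => x ^ 2) (2 * x) x := by
      simpa using hasDerivAt_pow 2 x
    refine HasDerivAt.congr_deriv (f := Φ)
      ((d0.sub_const (a ^ 2)).rpow_const (p := p) (Or.inl hu.ne')) ?_
    simp only [hΦ']; ring
  have hpos : ∀ x ∈ Set.Ioo a b, 0 ≤ Φ' x := by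
    intro x hx
    have hu : 0 < x ^ 2 - a ^ 2 := by nlinarith [hx.1, hx.2]
    have hx0 : 0 < x := by linarith [hx.1]
    simp only [hΦ']; positivity
  have hint : IntervalIntegrable Φ' MeasureTheory.volume a b :=
    (intervalIntegrable_iff_integrableOn_Ioc_of_le hab).2
      (intervalIntegral.integrableOn_deriv_of_nonneg hcont hderiv hpos)
  have hval := intervalIntegral.integral_eq_sub_of_hasDerivAt_of_le hab hcont hderiv hint
  have hval2 : Φ b - Φ a = (1 / 2) ^ p * auxF p t D := by
    simp only [hΦ, sub_self, Real.zero_rpow hp0.ne', hb2]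
    unfold auxF
    rw [← hR, ← Real.mul_rpow (by norm_num) hR0.le, sub_zero]
    congr 1; ring
  set K := c * (Real.exp (-a ^ 2 / t) * D ^ (p - 1)) with hK
  have hsub : IntervalIntegrable (auxH p a t) MeasureTheory.volume a b :=
    hintH.mono_set (by
      rw [Set.uIcc_of_le hab, Set.uIcc_of_le (hab.trans hbp)]
      exact Set.Icc_subset_Icc_right hbp)
  have hsub2 : IntervalIntegrable (auxH p a t) MeasureTheory.volume b (Real.pi - a) :=
    hintH.mono_set (by
      rw [Set.uIcc_of_le hbp, Set.uIcc_of_le (hab.trans hbp)]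
      exact Set.Icc_subset_Icc_left hab)
  have hle : ∀ x ∈ Set.Ioo a b, K * Φ' x ≤ auxH p a t x := by
    intro x hx
    have hxb : x ^ 2 ≤ b ^ 2 := by nlinarith [hx.1, hx.2]
    exact H a t x ha ha2 ht ht1 hx.1 (hx.2.trans_le hbp) (by linarith) (by linarith)
  have h1 : ∫ ψ in a..b, K * Φ' ψ ≤ ∫ ψ in a..b, auxH p a t ψ :=
    intervalIntegral.integral_mono_on_of_le_Ioo hab (hint.const_mul K) hsub hle
  have h2 : 0 ≤ ∫ ψ in b..(Real.pi - a), auxH p a t ψ := by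
    have := intervalIntegral.integral_mono_on_of_le_Ioo hbp
      (intervalIntegrable_const (c := (0:ℝ))) hsub2
      (fun x hx => auxH_nonneg p a t x ha ht (hab.trans_lt hx.1) hx.2)
    simpa using this
  rw [← intervalIntegral.integral_add_adjacent_intervals hsub hsub2]
  rw [intervalIntegral.integral_const_mul, hval, hval2] at h1
  calc _ = K * ((1 / 2) ^ p * auxF p t D) := by rw [hK]; ring
    _ ≤ _ := by linarith

lemma aux_final (p : ℝ) : ∃ c C : ℝ, 0 < c ∧ 0 < C ∧ ∀ a t : ℝ, 0 < a →
    a < Real.pi / 2 → 0 < t →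
    c * (Real.cos a ^ (2 * p - 1) * (t + Real.pi - 2 * a) ^ (-p) * t ^ (-(p + 1 / 2))) ≤
      t ^ (-(2 * p + 1 / 2)) * ((Real.pi * (Real.pi - 2 * a)) ^ (p - 1) *
        auxF p t (Real.pi * (Real.pi - 2 * a))) ∧
      t ^ (-(2 * p + 1 / 2)) * ((Real.pi * (Real.pi - 2 * a)) ^ (p - 1) *
        auxF p t (Real.pi * (Real.pi - 2 * a))) ≤
    C * (Real.cos a ^ (2 * p - 1) * (t + Real.pi - 2 * a) ^ (-p) * t ^ (-(p + 1 / 2))) := by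
  have hpi := Real.pi_pos
  have p3 := Real.pi_gt_three
  obtain ⟨c1, C1, hc1, hC1, H1⟩ := aux_rpow_comp (2 * p - 1) (2 * Real.pi) (Real.pi ^ 2)
    (by positivity) (by positivity)
  obtain ⟨c2, C2, hc2, hC2, H2⟩ := aux_rpow_comp (-p) 1 Real.pi one_pos hpi
  refine ⟨c1 * c2, C1 * C2, by positivity, by positivity, ?_⟩
  intro a t ha ha2 ht
  have hL : 0 < Real.pi - 2 * a := by linarith
  have hcos : 0 < Real.cos a := Real.cos_pos_of_mem_Ioo ⟨by linarith, ha2⟩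
  have hs : Real.cos a = Real.sin (Real.pi / 2 - a) := (Real.sin_pi_div_two_sub a).symm
  have k1 : 2 * Real.pi * Real.cos a ≤ Real.pi * (Real.pi - 2 * a) := by
    have : Real.cos a ≤ Real.pi / 2 - a := hs ▸ Real.sin_le (by linarith)
    nlinarith
  have k2 : Real.pi * (Real.pi - 2 * a) ≤ Real.pi ^ 2 * Real.cos a := by
    have : 2 / Real.pi * (Real.pi / 2 - a) ≤ Real.cos a :=
      hs ▸ Real.mul_le_sin (by linarith) (by linarith)
    calc _ = Real.pi ^ 2 * (2 / Real.pi * (Real.pi / 2 - a)) := by field_simp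
      _ ≤ _ := by gcongr
  obtain ⟨g1, g2⟩ := H1 _ _ hcos k1 k2
  have hB : 0 < t + Real.pi - 2 * a := by linarith
  obtain ⟨f1, f2⟩ := H2 (t + Real.pi - 2 * a) (t + Real.pi * (Real.pi - 2 * a)) hB
    (by nlinarith) (by nlinarith)
  have hD : 0 < Real.pi * (Real.pi - 2 * a) := mul_pos hpi hL
  generalize Real.pi * (Real.pi - 2 * a) = D at *
  have e : t ^ (-(2 * p + 1 / 2)) * (D ^ (p - 1) * auxF p t D) =
      D ^ (2 * p - 1) * (t + D) ^ (-p) * t ^ (-(p + 1 / 2)) := by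
    unfold auxF
    have e1 : D / (1 + D / t) = D * t * (t + D)⁻¹ := by field_simp
    rw [e1, Real.mul_rpow (by positivity) (by positivity), Real.mul_rpow hD.le ht.le,
      Real.inv_rpow (by positivity), ← Real.rpow_neg (by positivity)]
    have e2 : D ^ (2 * p - 1) = D ^ (p - 1) * D ^ p := by
      rw [← Real.rpow_add hD]; congr 1; ring
    have e3 : t ^ (-(p + 1 / 2)) = t ^ (-(2 * p + 1 / 2)) * t ^ p := by
      rw [← Real.rpow_add ht]; congr 1; ring
    rw [e2, e3]; ring
  rw [e]
  have ht' : 0 < t ^ (-(p + 1 / 2)) := by positivity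
  constructor
  · calc _ = (c1 * Real.cos a ^ (2 * p - 1)) * (c2 * (t + Real.pi - 2 * a) ^ (-p)) *
          t ^ (-(p + 1 / 2)) := by ring
      _ ≤ _ := by gcongr
  · calc _ ≤ (C1 * Real.cos a ^ (2 * p - 1)) * (C2 * (t + Real.pi - 2 * a) ^ (-p)) *
          t ^ (-(p + 1 / 2)) := by gcongr
      _ = _ := by ring

/-- The analytic core of the reduction step (Section 5 of the paper): a sharp two-sided bound
for the integral expressing the dimension-`N` spherical heat kernel through the
dimension-`2N-1` one. -/
theorem reduction_integral_sharp_estimate (N : ℕ) (hN : 2 ≤ N) :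
    ∃ c C : ℝ, 0 < c ∧ 0 < C ∧
      ∀ φ t : ℝ, φ ∈ Set.Ioo 0 Real.pi → 0 < t → t ≤ 1 →
        c * Real.cos (φ / 2) ^ (N - 2) * (t + Real.pi - φ) ^ (-((N : ℝ) - 1) / 2) *
            t ^ (-(N : ℝ) / 2) * Real.exp (-φ ^ 2 / (4 * t)) ≤
          (∫ ψ in (φ / 2)..(Real.pi - φ / 2),
            (t + Real.pi - ψ) ^ (-((N : ℝ) - 1)) * t ^ (-((N : ℝ) - 1 / 2)) *
              Real.exp (-ψ ^ 2 / t) *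
              (Real.cos φ - Real.cos (2 * ψ)) ^ (((N : ℝ) - 3) / 2) * Real.sin ψ) ∧
        (∫ ψ in (φ / 2)..(Real.pi - φ / 2),
            (t + Real.pi - ψ) ^ (-((N : ℝ) - 1)) * t ^ (-((N : ℝ) - 1 / 2)) *
              Real.exp (-ψ ^ 2 / t) *
              (Real.cos φ - Real.cos (2 * ψ)) ^ (((N : ℝ) - 3) / 2) * Real.sin ψ) ≤
          C * Real.cos (φ / 2) ^ (N - 2) * (t + Real.pi - φ) ^ (-((N : ℝ) - 1) / 2) *
            t ^ (-(N : ℝ) / 2) * Real.exp (-φ ^ 2 / (4 * t)) := by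
  have hN' : (2:ℝ) ≤ N := by exact_mod_cast hN
  obtain ⟨p, hp⟩ : ∃ p : ℝ, p = ((N:ℝ) - 1) / 2 := ⟨_, rfl⟩
  have hp0 : 0 < p := by rw [hp]; linarith
  obtain ⟨C1, hC1, HU⟩ := aux_int_upper p hp0
  obtain ⟨c1, hc1, HL⟩ := aux_int_lower p hp0
  obtain ⟨c2, C2, hc2, hC2, HF⟩ := aux_final p
  refine ⟨c1 * c2, C1 * C2, by positivity, by positivity, ?_⟩
  intro φ t hφ ht ht1
  obtain ⟨a, rfl⟩ : ∃ a : ℝ, φ = 2 * a := ⟨φ / 2, by ring⟩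
  have ha : 0 < a := by linarith [hφ.1]
  have ha2 : a < Real.pi / 2 := by linarith [hφ.2]
  have hcos : 0 < Real.cos a := Real.cos_pos_of_mem_Ioo ⟨by linarith, ha2⟩
  have ea : 2 * a / 2 = a := by ring
  have ex1 : -((N:ℝ) - 1) = -(2 * p) := by rw [hp]; ring
  have ex2 : -((N:ℝ) - 1 / 2) = -(2 * p + 1 / 2) := by rw [hp]; ring
  have ex3 : ((N:ℝ) - 3) / 2 = p - 1 := by rw [hp]; ring
  have ex4 : -((N:ℝ) - 1) / 2 = -p := by rw [hp]; ring
  have ex5 : -(N:ℝ) / 2 = -(p + 1 / 2) := by rw [hp]; ring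
  have ex6 : Real.cos a ^ (N - 2) = Real.cos a ^ (2 * p - 1) := by
    rw [← Real.rpow_natCast, Nat.cast_sub hN]; congr 1; rw [hp]; push_cast; ring
  have ex7 : -(2 * a) ^ 2 / (4 * t) = -a ^ 2 / t := by field_simp; ring
  rw [ex4, ex1, ex2, ex3, ex5, ea, ex6, ex7]
  have eI : (∫ ψ in a..(Real.pi - a), (t + Real.pi - ψ) ^ (-(2 * p)) * t ^ (-(2 * p + 1 / 2)) *
      Real.exp (-ψ ^ 2 / t) * (Real.cos (2 * a) - Real.cos (2 * ψ)) ^ (p - 1) * Real.sin ψ) =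
      t ^ (-(2 * p + 1 / 2)) * ∫ ψ in a..(Real.pi - a), auxH p a t ψ := by
    rw [← intervalIntegral.integral_const_mul]
    congr 1
    funext ψ
    unfold auxH; ring
  rw [eI]
  have hU := (HU a t ha ha2 ht).2
  have hL := HL a t ha ha2 ht ht1
  obtain ⟨f1, f2⟩ := HF a t ha ha2 ht
  have hT : 0 < t ^ (-(2 * p + 1 / 2)) := by positivity
  have hE := Real.exp_pos (-a ^ 2 / t)
  constructor
  · calc _ = c1 * Real.exp (-a ^ 2 / t) * (c2 * (Real.cos a ^ (2 * p - 1) *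
          (t + Real.pi - 2 * a) ^ (-p) * t ^ (-(p + 1 / 2)))) := by ring
      _ ≤ _ := mul_le_mul_of_nonneg_left f1 (by positivity)
      _ = t ^ (-(2 * p + 1 / 2)) * (c1 * (Real.exp (-a ^ 2 / t) *
          (Real.pi * (Real.pi - 2 * a)) ^ (p - 1)) *
          auxF p t (Real.pi * (Real.pi - 2 * a))) := by ring
      _ ≤ _ := mul_le_mul_of_nonneg_left hL hT.le
  · calc _ ≤ _ := mul_le_mul_of_nonneg_left hU hT.le
      _ = C1 * Real.exp (-a ^ 2 / t) * (t ^ (-(2 * p + 1 / 2)) *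
          ((Real.pi * (Real.pi - 2 * a)) ^ (p - 1) *
          auxF p t (Real.pi * (Real.pi - 2 * a)))) := by ring
      _ ≤ _ := mul_le_mul_of_nonneg_left f2 (by positivity)
      _ = _ := by ring
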